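/- Define, for positive reals t, ω₀, ω₁, ω₂, the quantities A = ω₁ − ω₂·t + ω₀·t², B = ω₂ − ω₀·t + ω₁·t², C = ω₀ − ω₁·t + ω₂·t². Then the open set U = { (t, e, ω₀, ω₁, ω₂) ∈ (0,∞)⁵ : A ≠ 0, B ≠ 0, and C ≠ 0 } has exactly four connected components, namely { A > 0, B > 0, C > 0 }, { A < 0 }, { B < 0 }, and { C < 0 } (each intersected with (0,∞)⁵); these four sets are nonempty, pairwise disjoint, open, their union is U, and each is connected. -/

import Mathlib

/-- `A = ω₁ − ω₂·t + ω₀·t²`. -/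
def quantA (t w0 w1 w2 : ℝ) : ℝ := w1 - w2 * t + w0 * t ^ 2

/-- `B = ω₂ − ω₀·t + ω₁·t²`. -/
def quantB (t w0 w1 w2 : ℝ) : ℝ := w2 - w0 * t + w1 * t ^ 2

/-- `C = ω₀ − ω₁·t + ω₂·t²`. -/
def quantC (t w0 w1 w2 : ℝ) : ℝ := w0 - w1 * t + w2 * t ^ 2

/-- The open set `U = {A ≠ 0, B ≠ 0, C ≠ 0}` in `(0,∞)⁵`, coordinates `(t, e, ω₀, ω₁, ω₂)`. -/
def setU : Set (Fin 5 → ℝ) :=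
  {x | (∀ i, 0 < x i) ∧
    quantA (x 0) (x 2) (x 3) (x 4) ≠ 0 ∧
    quantB (x 0) (x 2) (x 3) (x 4) ≠ 0 ∧
    quantC (x 0) (x 2) (x 3) (x 4) ≠ 0}

/-- The component `{A > 0, B > 0, C > 0}` in `(0,∞)⁵`. -/
def compPos : Set (Fin 5 → ℝ) :=
  {x | (∀ i, 0 < x i) ∧
    0 < quantA (x 0) (x 2) (x 3) (x 4) ∧
    0 < quantB (x 0) (x 2) (x 3) (x 4) ∧
    0 < quantC (x 0) (x 2) (x 3) (x 4)}

/-- The component `{A < 0}` in `(0,∞)⁵`. -/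
def compA : Set (Fin 5 → ℝ) :=
  {x | (∀ i, 0 < x i) ∧ quantA (x 0) (x 2) (x 3) (x 4) < 0}

/-- The component `{B < 0}` in `(0,∞)⁵`. -/
def compB : Set (Fin 5 → ℝ) :=
  {x | (∀ i, 0 < x i) ∧ quantB (x 0) (x 2) (x 3) (x 4) < 0}

/-- The component `{C < 0}` in `(0,∞)⁵`. -/
def compC : Set (Fin 5 → ℝ) :=
  {x | (∀ i, 0 < x i) ∧ quantC (x 0) (x 2) (x 3) (x 4) < 0}

lemma quantA_add_mul_quantB (t w0 w1 w2 : ℝ) :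
    quantA t w0 w1 w2 + t * quantB t w0 w1 w2 = w1 * (1 + t ^ 3) := by
  simp only [quantA, quantB]; ring

lemma quantB_add_mul_quantC (t w0 w1 w2 : ℝ) :
    quantB t w0 w1 w2 + t * quantC t w0 w1 w2 = w2 * (1 + t ^ 3) := by
  simp only [quantB, quantC]; ring

lemma quantC_add_mul_quantA (t w0 w1 w2 : ℝ) :
    quantC t w0 w1 w2 + t * quantA t w0 w1 w2 = w0 * (1 + t ^ 3) := by
  simp only [quantA, quantC]; ring

lemma pos_of_add_mul_eq {p q t w : ℝ} (ht : 0 < t) (hw : 0 < w)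
    (h : p + t * q = w * (1 + t ^ 3)) : (p < 0 → 0 < q) ∧ (q < 0 → 0 < p) := by
  have hpos : 0 < p + t * q := h ▸ by positivity
  refine ⟨fun hp => ?_, fun hq => ?_⟩
  · exact pos_of_mul_pos_right (by linarith : 0 < t * q) ht.le
  · linarith [mul_neg_of_pos_of_neg ht hq]

/-- At most one of `A`, `B`, `C` is negative on the positive orthant. -/
lemma quant_pos_of_neg {x : Fin 5 → ℝ} (hx : ∀ i, 0 < x i) :
    (quantA (x 0) (x 2) (x 3) (x 4) < 0 →
      0 < quantB (x 0) (x 2) (x 3) (x 4) ∧ 0 < quantC (x 0) (x 2) (x 3) (x 4)) ∧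
    (quantB (x 0) (x 2) (x 3) (x 4) < 0 →
      0 < quantA (x 0) (x 2) (x 3) (x 4) ∧ 0 < quantC (x 0) (x 2) (x 3) (x 4)) ∧
    (quantC (x 0) (x 2) (x 3) (x 4) < 0 →
      0 < quantA (x 0) (x 2) (x 3) (x 4) ∧ 0 < quantB (x 0) (x 2) (x 3) (x 4)) := by
  have hAB := pos_of_add_mul_eq (hx 0) (hx 3) (quantA_add_mul_quantB (x 0) (x 2) (x 3) (x 4))
  have hBC := pos_of_add_mul_eq (hx 0) (hx 4) (quantB_add_mul_quantC (x 0) (x 2) (x 3) (x 4))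
  have hCA := pos_of_add_mul_eq (hx 0) (hx 2) (quantC_add_mul_quantA (x 0) (x 2) (x 3) (x 4))
  exact ⟨fun h => ⟨hAB.1 h, hCA.2 h⟩, fun h => ⟨hAB.2 h, hBC.1 h⟩, fun h => ⟨hCA.1 h, hBC.2 h⟩⟩

lemma isOpen_positive_orthant {ι : Type*} [Finite ι] : IsOpen {x : ι → ℝ | ∀ i, 0 < x i} := by
  simp only [Set.ofPred_forall]
  exact isOpen_iInter_of_finite fun i => isOpen_lt continuous_const (continuous_apply i)

lemma isConnected_positive_orthant {ι : Type*} : IsConnected {x : ι → ℝ | ∀ i, 0 < x i} := by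
  have h : {x : ι → ℝ | ∀ i, 0 < x i} = Set.univ.pi fun _ => Set.Ioi 0 := by
    ext x; simp
  rw [h]
  exact isConnected_univ_pi.2 fun _ => isConnected_Ioi

lemma IsConnected.of_rightInvOn {X Y : Type*} [TopologicalSpace X] [TopologicalSpace Y]
    {s : Set X} {u : Set Y} {f : X → Y} (g : Y → X) (hs : IsConnected s)
    (hf : ContinuousOn f s) (hfm : Set.MapsTo f s u) (hgm : Set.MapsTo g u s)
    (hfg : Set.RightInvOn g f u) : IsConnected u := by
  have h : f '' s = u :=
    hfm.image_subset.antisymm fun y hy => ⟨g y, hgm hy, hfg hy⟩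
  exact h ▸ hs.image f hf

lemma isConnected_compPos : IsConnected compPos := by
  refine isConnected_positive_orthant.of_rightInvOn
    (f := fun y : Fin 5 → ℝ => ![y 0, y 1, (y 4 + y 0 * y 2) / (1 + y 0 ^ 3),
      (y 2 + y 0 * y 3) / (1 + y 0 ^ 3), (y 3 + y 0 * y 4) / (1 + y 0 ^ 3)])
    (fun x => ![x 0, x 1, quantA (x 0) (x 2) (x 3) (x 4), quantB (x 0) (x 2) (x 3) (x 4),
      quantC (x 0) (x 2) (x 3) (x 4)]) ?_ ?_ ?_ ?_
  · have hne : ∀ y ∈ {y : Fin 5 → ℝ | ∀ i, 0 < y i}, 1 + y 0 ^ 3 ≠ 0 := fun y hy => by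
      have := hy 0
      positivity
    refine continuousOn_pi.2 fun i => ?_
    fin_cases i
    · exact (continuous_apply 0).continuousOn
    · exact (continuous_apply 1).continuousOn
    all_goals exact ContinuousOn.div (by fun_prop) (by fun_prop) hne
  · intro y hy
    have h0 := hy 0
    have h1 := hy 1
    have h2 := hy 2
    have h3 := hy 3
    have h4 := hy 4
    have hne : 1 + y 0 ^ 3 ≠ 0 := by positivity
    refine ⟨fun i => ?_, ?_, ?_, ?_⟩
    · fin_cases i <;> simp <;> positivity
    · convert h2 using 1
      simp [quantA]
      field_simp
      ring
    · convert h3 using 1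
      simp [quantB]
      field_simp
      ring
    · convert h4 using 1
      simp [quantC]
      field_simp
      ring
  · rintro x ⟨hx, hA, hB, hC⟩ i
    fin_cases i
    exacts [hx 0, hx 1, hA, hB, hC]
  · rintro x ⟨hx, -⟩
    have h0 := hx 0
    have hne : 1 + x 0 ^ 3 ≠ 0 := by positivity
    ext i
    fin_cases i
    · rfl
    · rfl
    · exact (div_eq_iff hne).2 (quantC_add_mul_quantA ..)
    · exact (div_eq_iff hne).2 (quantA_add_mul_quantB ..)
    · exact (div_eq_iff hne).2 (quantB_add_mul_quantC ..)

/-- The part of the positive orthant where `x j + x k * t ^ 2 < x i * t`, with `t = x l`, is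
connected. -/
lemma isConnected_setOf_add_mul_sq_lt {ι : Type*} [DecidableEq ι] {i j k l : ι}
    (hij : j ≠ i) (hik : k ≠ i) (hil : l ≠ i) :
    IsConnected {x : ι → ℝ | (∀ m, 0 < x m) ∧ x j - x i * x l + x k * x l ^ 2 < 0} := by
  refine isConnected_positive_orthant.of_rightInvOn
    (f := fun y : ι → ℝ => Function.update y i (y i + (y j / y l + y k * y l)))
    (fun x => Function.update x i (x i - (x j / x l + x k * x l))) ?_ ?_ ?_ ?_
  · have hdiv : ContinuousOn (fun y : ι → ℝ => y j / y l) {y | ∀ m, 0 < y m} :=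
      ContinuousOn.div (by fun_prop) (by fun_prop) fun y hy => (hy l).ne'
    have hi : ContinuousOn (fun y : ι → ℝ => y i + (y j / y l + y k * y l)) {y | ∀ m, 0 < y m} :=
      (continuous_apply i).continuousOn.add (hdiv.add (by fun_prop))
    exact fun y hy => continuousWithinAt_id.update i (hi y hy)
  · intro y hy
    have hi := hy i
    have hj := hy j
    have hk := hy k
    have hl := hy l
    refine ⟨fun m => ?_, ?_⟩
    · rcases eq_or_ne m i with rfl | hm
      · simp only [Function.update_self]
        positivity
      · simpa [hm] using hy m
    · have h : y j - (y i + (y j / y l + y k * y l)) * y l + y k * y l ^ 2 = -(y i * y l) := by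
        field_simp
        ring
      simp only [Function.update_self, Function.update_of_ne hij, Function.update_of_ne hik,
        Function.update_of_ne hil, h]
      exact neg_neg_of_pos (mul_pos hi hl)
  · rintro x ⟨hx, hlt⟩ m
    rcases eq_or_ne m i with rfl | hm
    · have hl := hx l
      have h : (x m - (x j / x l + x k * x l)) * x l =
          -(x j - x m * x l + x k * x l ^ 2) := by
        field_simp
        ring
      simp only [Function.update_self]
      exact pos_of_mul_pos_left (h ▸ neg_pos.2 hlt) hl.le
    · simpa [hm] using hx m
  · intro x _
    simp [hij, hik, hil]

theorem stmt_14 :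
    compPos.Nonempty ∧ compA.Nonempty ∧ compB.Nonempty ∧ compC.Nonempty ∧
    (Disjoint compPos compA ∧ Disjoint compPos compB ∧ Disjoint compPos compC ∧
      Disjoint compA compB ∧ Disjoint compA compC ∧ Disjoint compB compC) ∧
    (IsOpen compPos ∧ IsOpen compA ∧ IsOpen compB ∧ IsOpen compC) ∧
    compPos ∪ compA ∪ compB ∪ compC = setU ∧
    (IsConnected compPos ∧ IsConnected compA ∧ IsConnected compB ∧ IsConnected compC) := by
  have hP : IsConnected compPos := isConnected_compPos
  have hA : IsConnected compA :=
    isConnected_setOf_add_mul_sq_lt (i := 4) (j := 3) (k := 2) (l := 0)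
      (by decide) (by decide) (by decide)
  have hB : IsConnected compB :=
    isConnected_setOf_add_mul_sq_lt (i := 2) (j := 4) (k := 3) (l := 0)
      (by decide) (by decide) (by decide)
  have hC : IsConnected compC :=
    isConnected_setOf_add_mul_sq_lt (i := 3) (j := 2) (k := 4) (l := 0)
      (by decide) (by decide) (by decide)
  have cA : Continuous fun x : Fin 5 → ℝ => quantA (x 0) (x 2) (x 3) (x 4) := by
    unfold quantA; fun_prop
  have cB : Continuous fun x : Fin 5 → ℝ => quantB (x 0) (x 2) (x 3) (x 4) := by
    unfold quantB; fun_prop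
  have cC : Continuous fun x : Fin 5 → ℝ => quantC (x 0) (x 2) (x 3) (x 4) := by
    unfold quantC; fun_prop
  refine ⟨hP.nonempty, hA.nonempty, hB.nonempty, hC.nonempty,
    ⟨?_, ?_, ?_, ?_, ?_, ?_⟩, ⟨?_, ?_, ?_, ?_⟩, ?_, hP, hA, hB, hC⟩
  · exact Set.disjoint_left.2 fun x h h' => h.2.1.not_gt h'.2
  · exact Set.disjoint_left.2 fun x h h' => h.2.2.1.not_gt h'.2
  · exact Set.disjoint_left.2 fun x h h' => h.2.2.2.not_gt h'.2
  · exact Set.disjoint_left.2 fun x h h' => ((quant_pos_of_neg h.1).1 h.2).1.not_gt h'.2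
  · exact Set.disjoint_left.2 fun x h h' => ((quant_pos_of_neg h.1).1 h.2).2.not_gt h'.2
  · exact Set.disjoint_left.2 fun x h h' => ((quant_pos_of_neg h.1).2.1 h.2).2.not_gt h'.2
  · exact isOpen_positive_orthant.inter ((isOpen_lt continuous_const cA).inter
      ((isOpen_lt continuous_const cB).inter (isOpen_lt continuous_const cC)))
  · exact isOpen_positive_orthant.inter (isOpen_lt cA continuous_const)
  · exact isOpen_positive_orthant.inter (isOpen_lt cB continuous_const)
  · exact isOpen_positive_orthant.inter (isOpen_lt cC continuous_const)
  · ext x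
    constructor
    · rintro (((⟨hx, hA, hB, hC⟩ | ⟨hx, h⟩) | ⟨hx, h⟩) | ⟨hx, h⟩)
      · exact ⟨hx, hA.ne', hB.ne', hC.ne'⟩
      · obtain ⟨hB, hC⟩ := (quant_pos_of_neg hx).1 h
        exact ⟨hx, h.ne, hB.ne', hC.ne'⟩
      · obtain ⟨hA, hC⟩ := (quant_pos_of_neg hx).2.1 h
        exact ⟨hx, hA.ne', h.ne, hC.ne'⟩
      · obtain ⟨hA, hB⟩ := (quant_pos_of_neg hx).2.2 h
        exact ⟨hx, hA.ne', hB.ne', h.ne⟩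
    · rintro ⟨hx, hA, hB, hC⟩
      rcases hA.lt_or_gt with hA | hA
      · exact .inl (.inl (.inr ⟨hx, hA⟩))
      rcases hB.lt_or_gt with hB | hB
      · exact .inl (.inr ⟨hx, hB⟩)
      rcases hC.lt_or_gt with hC | hC
      · exact .inr ⟨hx, hC⟩
      · exact .inl (.inl (.inl ⟨hx, hA, hB, hC⟩))
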